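/- Let r⃗ ∈ R^n with r⃗ ∉ R^n(ε), and suppose n = 2dm is such that E(LC*_n) ≥ γ*_k·n − (n/4)(γ*_k − γ^e_k)·p·ε. Then E( LC*_n(r⃗) − LC*_n ) ≤ −(3/4)(γ*_k − γ^e_k)·p·ε·n. -/

import Mathlib

open scoped Classical ENNReal

/-- The length of a longest common subsequence (LCS) of two lists:
the maximal length of a list that is a sublist (subsequence) of both. -/
noncomputable def lcsLength {α : Type*} (x y : List α) : ℕ :=
  sSup {L : ℕ | ∃ z : List α, z.Sublist x ∧ z.Sublist y ∧ z.length = L}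

/-- The string made of the first `n` letters of an infinite sequence of letters. -/
def strN {k : ℕ} (x : ℕ → Fin k) (n : ℕ) : List (Fin k) := (List.range n).map x

/-- The score of the best alignment of `x` and `y` under the constraints given by the
partition `r`: block `i` of `x` (of length `2d`) is aligned with `y_{r i + 1} ⋯ y_{r (i+1)}`. -/
noncomputable def score {α : Type*} (d m : ℕ) (r : ℕ → ℕ) (x y : List α) : ℕ :=
  ∑ i ∈ Finset.range m,
    lcsLength ((x.drop (2*d*i)).take (2*d)) ((y.drop (r i)).take (r (i+1) - r i))

/-- `r` is a partition `0 = r 0 ≤ r 1 ≤ ⋯ ≤ r m = n` of `[0,n]` into `m` pieces. -/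
def IsPartition (n m : ℕ) (r : ℕ → ℕ) : Prop :=
  r 0 = 0 ∧ (∀ i, i < m → r i ≤ r (i + 1)) ∧ r m = n

/-- `t` lies in the interval `I_d = [2d(1-qe)/(1+qe), 2d(1+qe)/(1-qe)]`. -/
def inI (d : ℕ) (qe t : ℝ) : Prop :=
  2*(d:ℝ)*(1-qe)/(1+qe) ≤ t ∧ t ≤ 2*(d:ℝ)*(1+qe)/(1-qe)

/-- The number of pieces of the partition `r` whose length falls outside `I_d`. -/
noncomputable def badCount (d m : ℕ) (qe : ℝ) (r : ℕ → ℕ) : ℕ :=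
  ((Finset.range m).filter (fun i => ¬ inI d qe ((r (i+1) : ℝ) - (r i : ℝ)))).card

/-- Membership in `R^n(ε)`: `r` is a partition of `[0,n]` into `m` pieces with at most
`2 m p ε` of the lengths `r (i+1) - r i` outside the interval `I_d`. -/
noncomputable def memReps (d m : ℕ) (p ε qe : ℝ) (n : ℕ) (r : ℕ → ℕ) : Prop :=
  IsPartition n m r ∧ (badCount d m qe r : ℝ) ≤ 2*(m:ℝ)*p*ε

/-- Expected length of the LCS of two independent strings of lengths `a` and `b` of
iid letters uniform on a `k`-letter alphabet. -/
noncomputable def expLCS (k a b : ℕ) : ℝ :=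
  (∑ x : Fin a → Fin k, ∑ y : Fin b → Fin k,
    (lcsLength (List.ofFn x) (List.ofFn y) : ℝ)) / ((k : ℝ)^a * (k : ℝ)^b)

/-- The mean LCS-function `γ_k(q) = lim_n E|LCS(V_1⋯V_{n-nq}; W_1⋯W_{n+nq})|/n`
(the limit exists by superadditivity; we realize it as a `limsup`). -/
noncomputable def gammaLim (k : ℕ) (q : ℝ) : ℝ :=
  Filter.limsup
    (fun n : ℕ => expLCS k ((n : ℤ) - ⌊(n : ℝ) * q⌋).toNat ((n : ℤ) + ⌊(n : ℝ) * q⌋).toNat / n)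
    Filter.atTop

/-- The uniform probability measure on a finite type. -/
noncomputable def unifM (α : Type*) [MeasurableSpace α] [Fintype α] :
    MeasureTheory.Measure α :=
  (Fintype.card α : ℝ≥0∞)⁻¹ • MeasureTheory.Measure.count

/-- The Bernoulli(p) measure on `Bool`. -/
noncomputable def bern (p : ℝ) : MeasureTheory.Measure Bool :=
  ENNReal.ofReal p • MeasureTheory.Measure.dirac true
    + ENNReal.ofReal (1 - p) • MeasureTheory.Measure.dirac false

/-- `pos` (a 1-based position) belongs to the block interval
`J_{i+1} = [(2i+1)d - ℓ/2, (2i+1)d + ℓ/2]` (here `i` is 0-based). -/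
def memJ (d l i pos : ℕ) : Prop :=
  (2*i+1)*d ≤ pos + l/2 ∧ pos ≤ (2*i+1)*d + l/2

/-- The number of long blocks: the number of indices `i < m` with `Z i = true`. -/
noncomputable def numBlocks (m : ℕ) (Zω : ℕ → Bool) : ℕ :=
  ((Finset.range m).filter (fun i => Zω i = true)).card

/-- The (0-based) index of the `j`-th long block (`j` 1-based). -/
noncomputable def blockIdx (m : ℕ) (Zω : ℕ → Bool) (j : ℕ) : ℕ :=
  (((Finset.range m).filter (fun i => Zω i = true)).sort (· ≤ ·)).getD (j - 1) 0

/-- Average of `F` over all strings of length `N`. -/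
noncomputable def avgS (k N : ℕ) (F : List (Fin k) → ℝ) : ℝ :=
  (∑ x : Fin N → Fin k, F (List.ofFn x)) / (k : ℝ)^N

lemma avgS_mono {k N : ℕ} {F G : List (Fin k) → ℝ} (h : ∀ u, u.length = N → F u ≤ G u) :
    avgS k N F ≤ avgS k N G := by
  unfold avgS
  have : (∑ x : Fin N → Fin k, F (List.ofFn x)) ≤ ∑ x : Fin N → Fin k, G (List.ofFn x) :=
    Finset.sum_le_sum fun x _ => h _ (by simp)
  gcongr

lemma avgS_congr {k N : ℕ} {F G : List (Fin k) → ℝ} (h : ∀ u, u.length = N → F u = G u) :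
    avgS k N F = avgS k N G :=
  le_antisymm (avgS_mono fun u hu => (h u hu).le) (avgS_mono fun u hu => (h u hu).ge)

lemma avgS_const {k N : ℕ} (hk : 2 ≤ k) (c : ℝ) : avgS k N (fun _ => c) = c := by
  unfold avgS
  have : (k : ℝ) ≠ 0 := by positivity
  simp
  field_simp

lemma avgS_add {k N : ℕ} (F G : List (Fin k) → ℝ) :
    avgS k N (fun u => F u + G u) = avgS k N F + avgS k N G := by
  unfold avgS
  rw [Finset.sum_add_distrib, add_div]

lemma avgS_sum {k N : ℕ} {ι : Type*} (s : Finset ι) (F : ι → List (Fin k) → ℝ) :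
    avgS k N (fun u => ∑ i ∈ s, F i u) = ∑ i ∈ s, avgS k N (F i) := by
  unfold avgS
  rw [Finset.sum_comm, Finset.sum_div]

lemma avgS_append {k a b : ℕ} (F : List (Fin k) → ℝ) :
    avgS k (a + b) F = avgS k a (fun u => avgS k b (fun v => F (u ++ v))) := by
  unfold avgS
  rw [← (Fin.appendEquiv a b).sum_comp, Fintype.sum_prod_type, ← Finset.sum_div, div_div,
    pow_add, mul_comm ((k:ℝ)^b)]
  simp [Fin.appendEquiv, List.ofFn_fin_append]

lemma avgS_comm {k a b : ℕ} (F : List (Fin k) → List (Fin k) → ℝ) :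
    avgS k a (fun u => avgS k b (fun v => F u v)) = avgS k b (fun v => avgS k a (fun u => F u v)) := by
  unfold avgS
  rw [← Finset.sum_div, ← Finset.sum_div, Finset.sum_comm, div_div, div_div, mul_comm]

lemma avgS_window {k N a b : ℕ} (hk : 2 ≤ k) (h : a + b ≤ N) (F : List (Fin k) → ℝ) :
    avgS k N (fun u => F ((u.drop a).take b)) = avgS k b F := by
  obtain ⟨c, rfl⟩ := Nat.exists_eq_add_of_le h
  rw [avgS_append, avgS_append]
  rw [avgS_congr (G := fun _ => avgS k b F), avgS_const hk]
  intro u hu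
  apply avgS_congr
  intro v hv
  rw [avgS_congr (G := fun _ => F v), avgS_const hk]
  intro w _
  simp [← hu, ← hv]

lemma lcs_bdd {α : Type*} (x y : List α) :
    BddAbove {L : ℕ | ∃ z : List α, z.Sublist x ∧ z.Sublist y ∧ z.length = L} :=
  ⟨x.length, by rintro L ⟨z, h, _, rfl⟩; exact h.length_le⟩

lemma lcs_spec {α : Type*} (x y : List α) :
    ∃ z : List α, z.Sublist x ∧ z.Sublist y ∧ z.length = lcsLength x y :=
  Nat.sSup_mem (s := {L : ℕ | ∃ z : List α, z.Sublist x ∧ z.Sublist y ∧ z.length = L})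
    ⟨0, [], by simp⟩ (lcs_bdd x y)

lemma le_lcs {α : Type*} {x y z : List α} (h : z.Sublist x) (h' : z.Sublist y) :
    z.length ≤ lcsLength x y := le_csSup (lcs_bdd x y) ⟨z, h, h', rfl⟩

lemma lcs_append {α : Type*} (x y x' y' : List α) :
    lcsLength x y + lcsLength x' y' ≤ lcsLength (x ++ x') (y ++ y') := by
  obtain ⟨z, h1, h2, h3⟩ := lcs_spec x y
  obtain ⟨z', h1', h2', h3'⟩ := lcs_spec x' y'
  rw [← h3, ← h3', ← List.length_append]
  exact le_lcs (h1.append h1') (h2.append h2')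

lemma lcs_comm {α : Type*} (x y : List α) : lcsLength x y = lcsLength y x := by
  unfold lcsLength
  congr 1; ext L
  exact exists_congr fun z => by tauto

lemma lcs_le {α : Type*} (x y : List α) : lcsLength x y ≤ x.length := by
  obtain ⟨z, h1, h2, h3⟩ := lcs_spec x y
  exact h3 ▸ h1.length_le

lemma expLCS_eq (k a b : ℕ) :
    expLCS k a b = avgS k a (fun x => avgS k b (fun y => (lcsLength x y : ℝ))) := by
  unfold expLCS avgS
  rw [← Finset.sum_div, div_div, mul_comm]

lemma expLCS_nonneg (k a b : ℕ) : 0 ≤ expLCS k a b := by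
  unfold expLCS; positivity

lemma expLCS_comm (k a b : ℕ) : expLCS k a b = expLCS k b a := by
  rw [expLCS_eq, expLCS_eq, avgS_comm]
  simp_rw [lcs_comm]

lemma expLCS_le {k : ℕ} (hk : 2 ≤ k) (a b : ℕ) : expLCS k a b ≤ a := by
  rw [expLCS_eq, ← avgS_const (N := a) hk (a : ℝ)]
  apply avgS_mono
  intro u hu
  conv_rhs => rw [← avgS_const (N := b) hk (a : ℝ)]
  apply avgS_mono
  intro v _
  exact_mod_cast hu ▸ lcs_le u v

lemma expLCS_super {k : ℕ} (hk : 2 ≤ k) (a b a' b' : ℕ) :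
    expLCS k a b + expLCS k a' b' ≤ expLCS k (a + a') (b + b') := by
  have key : avgS k a (fun x => avgS k a' (fun x' => avgS k b (fun y => avgS k b' (fun y' =>
      (lcsLength x y : ℝ) + lcsLength x' y')))) ≤ expLCS k (a + a') (b + b') := by
    rw [expLCS_eq, avgS_append]
    apply avgS_mono; intro x _
    apply avgS_mono; intro x' _
    rw [avgS_append]
    apply avgS_mono; intro y _
    apply avgS_mono; intro y' _
    exact_mod_cast lcs_append x y x' y'
  refine le_trans (le_of_eq ?_) key
  simp_rw [avgS_add, avgS_const hk]
  rw [expLCS_eq, expLCS_eq]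

lemma expLCS_mono {k : ℕ} (hk : 2 ≤ k) {a b a' b' : ℕ} (h : a ≤ a') (h' : b ≤ b') :
    expLCS k a b ≤ expLCS k a' b' := by
  obtain ⟨c, rfl⟩ := Nat.exists_eq_add_of_le h
  obtain ⟨e, rfl⟩ := Nat.exists_eq_add_of_le h'
  linarith [expLCS_super hk a b c e, expLCS_nonneg k c e]

lemma expLCS_mul {k : ℕ} (hk : 2 ≤ k) (a b u : ℕ) :
    u * expLCS k a b ≤ expLCS k (u * a) (u * b) := by
  induction u with
  | zero => simpa using expLCS_nonneg k 0 0
  | succ u ih =>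
    have := expLCS_super hk (u * a) (u * b) a b
    rw [Nat.succ_mul, Nat.succ_mul]
    push_cast
    linarith

lemma expLCS_le_gamma {k : ℕ} (hk : 2 ≤ k) (a b : ℕ) (hab : a ≤ b) (hs : 0 < b) (q : ℝ)
    (hq : 0 ≤ q) (hq1 : q ≤ 1) (hqs : q * (a + b) ≤ b - a) :
    expLCS k a b ≤ ((a : ℝ) + b) / 2 * gammaLim k q := by
  have hs' : (0 : ℝ) < a + b := by positivity
  have hab' : (a : ℝ) ≤ b := by exact_mod_cast hab
  obtain ⟨t, ht, ht0, ht1⟩ : ∃ t : ℝ, t * (b - a) = q ∧ 0 ≤ t ∧ t ≤ 1 / (a + b) := by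
    rcases hab'.eq_or_lt with h | h
    · refine ⟨0, ?_, le_rfl, by positivity⟩
      have : q * (a + b) ≤ 0 := by linarith
      have : q ≤ 0 := by by_contra! hc; nlinarith
      linarith
    · have h' : (0 : ℝ) < b - a := by linarith
      refine ⟨q / (b - a), by field_simp, by positivity, ?_⟩
      rw [div_le_div_iff₀ h' hs']; linarith
  set c := expLCS k a b with hc
  have hc0 : 0 ≤ c := expLCS_nonneg k a b
  set g : ℕ → ℝ := fun n : ℕ =>
    expLCS k ((n : ℤ) - ⌊(n : ℝ) * q⌋).toNat ((n : ℤ) + ⌊(n : ℝ) * q⌋).toNat / n with hg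
  have hgle : ∀ n, g n ≤ 1 := by
    intro n
    apply div_le_one_of_le₀ _ (by positivity)
    refine (expLCS_le hk _ _).trans ?_
    have : 0 ≤ ⌊(n : ℝ) * q⌋ := Int.floor_nonneg.2 (by positivity)
    exact_mod_cast (by omega : ((n : ℤ) - ⌊(n : ℝ) * q⌋).toNat ≤ n)
  have hlow : ∀ n : ℕ, 1 ≤ n → 2 * c / (a + b) - 2 * c / n ≤ g n := by
    intro n hn
    have hn0 : (0 : ℝ) < n := by exact_mod_cast hn
    set F := ⌊(n : ℝ) * q⌋ with hF
    have hF1 : (F : ℝ) ≤ n * q := Int.floor_le _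
    set U : ℝ := n * (1 / (a + b) + t)
    set V : ℝ := n * (1 / (a + b) - t)
    have hU0 : 0 ≤ U := by positivity
    have hV0 : 0 ≤ V := mul_nonneg hn0.le (by linarith)
    set u := ⌊U⌋₊
    set v := ⌊V⌋₊
    have hu : (u : ℝ) ≤ U := Nat.floor_le hU0
    have hv : (v : ℝ) ≤ V := Nat.floor_le hV0
    have hu1 : U < u + 1 := Nat.lt_floor_add_one U
    have hv1 : V < v + 1 := Nat.lt_floor_add_one V
    have e1 : U * a + V * b = n * (1 - q) := by
      simp only [U, V]; rw [← ht]; field_simp; ring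
    have e2 : U * b + V * a = n * (1 + q) := by
      simp only [U, V]; rw [← ht]; field_simp; ring
    have e3 : U + V = 2 * n / (a + b) := by
      simp only [U, V]; ring
    have a0 : (0 : ℝ) ≤ a := by positivity
    have b0 : (0 : ℝ) ≤ b := by positivity
    have i1 : (u : ℝ) * a + v * b ≤ n * (1 - q) := by
      rw [← e1]; gcongr
    have i2 : (u : ℝ) * b + v * a ≤ n * (1 + q) := by
      rw [← e2]; gcongr
    have j1 : u * a + v * b ≤ ((n : ℤ) - F).toNat := by
      have : ((u * a + v * b : ℕ) : ℤ) ≤ (n : ℤ) - F := by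
        have : ((u : ℝ) * a + v * b) ≤ (n : ℝ) - F := by linarith
        exact_mod_cast this
      omega
    have j2 : u * b + v * a ≤ ((n : ℤ) + F).toNat := by
      have : ((u * b + v * a : ℕ) : ℤ) - n ≤ F := by
        apply Int.le_floor.2
        push_cast
        linarith
      omega
    have k1 : (u + v) * c ≤ expLCS k ((n : ℤ) - F).toNat ((n : ℤ) + F).toNat := by
      refine le_trans ?_ (expLCS_mono hk j1 j2)
      refine le_trans ?_ (expLCS_super hk _ _ _ _)
      have h1 := expLCS_mul hk a b u
      have h2 := expLCS_mul hk b a v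
      rw [expLCS_comm k b a] at h2
      linarith
    have k2 : (2 * n / (a + b) - 2) * c ≤ expLCS k ((n : ℤ) - F).toNat ((n : ℤ) + F).toNat := by
      refine le_trans ?_ k1
      gcongr
      linarith
    simp only [hg]
    rw [le_div_iff₀ hn0]
    refine le_trans (le_of_eq ?_) k2
    field_simp
  have hlim : Filter.Tendsto (fun n : ℕ => 2 * c / (a + b) - 2 * c / (n : ℝ)) Filter.atTop
      (nhds (2 * c / (a + b))) := by
    simpa using tendsto_const_nhds.sub (tendsto_const_div_atTop_nhds_zero_nat (2 * c))
  have : 2 * c / (a + b) ≤ gammaLim k q := by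
    rw [← hlim.limsup_eq]
    apply Filter.limsup_le_limsup
    · filter_upwards [Filter.eventually_ge_atTop 1] with n hn using hlow n hn
    · exact hlim.isCoboundedUnder_le
    · exact Filter.isBoundedUnder_of ⟨1, hgle⟩
  rw [div_le_iff₀ hs'] at this
  linarith

lemma expLCS_le_gamma' {k : ℕ} (hk : 2 ≤ k) (a b : ℕ) (hs : 0 < a) (q : ℝ)
    (hq : 0 ≤ q) (hq1 : q ≤ 1) (hqs : q * (a + b) ≤ |(b : ℝ) - a|) :
    expLCS k a b ≤ ((a : ℝ) + b) / 2 * gammaLim k q := by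
  rcases le_total a b with h | h
  · apply expLCS_le_gamma hk a b h (by omega) q hq hq1
    rwa [abs_of_nonneg] at hqs
    have : (a : ℝ) ≤ b := by exact_mod_cast h
    linarith
  · rw [expLCS_comm, add_comm (a : ℝ)]
    apply expLCS_le_gamma hk b a h hs q hq hq1
    rw [abs_of_nonpos] at hqs
    · linarith
    have : (b : ℝ) ≤ a := by exact_mod_cast h
    linarith

lemma integral_unif_prod {k N : ℕ} (hk : 2 ≤ k) (G : List (Fin k) → List (Fin k) → ℝ) :
    ∫ z, G (List.ofFn z.1) (List.ofFn z.2)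
      ∂((unifM (Fin N → Fin k)).prod (unifM (Fin N → Fin k)))
      = avgS k N (fun x => avgS k N (fun y => G x y)) := by
  haveI : Nonempty (Fin k) := ⟨⟨0, by omega⟩⟩
  have hc : (Fintype.card (Fin N → Fin k) : ℝ≥0∞) ≠ 0 := by
    simp; intro h; omega
  haveI : MeasureTheory.IsFiniteMeasure (unifM (Fin N → Fin k)) := by
    refine ⟨?_⟩
    unfold unifM
    rw [MeasureTheory.Measure.smul_apply, smul_eq_mul]
    apply ENNReal.mul_lt_top
    · exact ENNReal.inv_lt_top.2 (pos_iff_ne_zero.2 hc)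
    · exact MeasureTheory.measure_lt_top _ _
  have h1 : ∀ F : (Fin N → Fin k) → ℝ, ∫ x, F x ∂(unifM (Fin N → Fin k))
      = (∑ x, F x) / (k : ℝ)^N := by
    intro F
    unfold unifM
    rw [MeasureTheory.integral_smul_measure, MeasureTheory.integral_count]
    simp
    ring
  rw [MeasureTheory.integral_prod _ (MeasureTheory.Integrable.of_finite)]
  simp_rw [h1]
  rfl

lemma integral_strN {Ω : Type*} [MeasurableSpace Ω] (P : MeasureTheory.Measure Ω)
    (k N : ℕ) (hk : 2 ≤ k)
    (Xstar Y : Ω → ℕ → Fin k) (hmX : Measurable Xstar) (hmY : Measurable Y)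
    (hlaw : MeasureTheory.Measure.map
        (fun ω => ((fun i : Fin N => Xstar ω i), (fun i : Fin N => Y ω i))) P
      = (unifM (Fin N → Fin k)).prod (unifM (Fin N → Fin k)))
    (G : List (Fin k) → List (Fin k) → ℝ) :
    ∫ ω, G (strN (Xstar ω) N) (strN (Y ω) N) ∂P
      = avgS k N (fun x => avgS k N (fun y => G x y)) := by
  rw [← integral_unif_prod hk, ← hlaw, MeasureTheory.integral_map]
  · have : ∀ x : ℕ → Fin k, strN x N = List.ofFn (fun i : Fin N => x i) := by
      intro x
      unfold strN
      apply List.ext_getElem <;> simp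
    simp_rw [this]
  · apply Measurable.aemeasurable
    refine Measurable.prodMk ?_ ?_ <;> refine measurable_pi_lambda _ fun i => ?_
    · exact (measurable_pi_apply _).comp hmX
    · exact (measurable_pi_apply _).comp hmY
  · exact (measurable_of_finite _).aestronglyMeasurable

lemma avg_score {k d m : ℕ} (hk : 2 ≤ k) (r : ℕ → ℕ) (hr : IsPartition (2*d*m) m r) :
    avgS k (2*d*m) (fun x => avgS k (2*d*m) (fun y => (score d m r x y : ℝ)))
      = ∑ i ∈ Finset.range m, expLCS k (2*d) (r (i+1) - r i) := by
  unfold score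
  push_cast
  simp_rw [avgS_sum]
  apply Finset.sum_congr rfl
  intro i hi
  rw [Finset.mem_range] at hi
  obtain ⟨h0, h1, h2⟩ := hr
  have hle : ∀ j, i + 1 ≤ j → j ≤ m → r (i+1) ≤ r j := by
    intro j hj
    induction j, hj using Nat.le_induction with
    | base => intro _; rfl
    | succ j hj ih => intro hjm; exact (ih (by omega)).trans (h1 j (by omega))
  have h3 := hle m hi le_rfl
  have h4 := h1 i hi
  have h5 : 2*d*i + 2*d ≤ 2*d*m := by
    calc 2*d*i + 2*d = 2*d*(i+1) := by ring
      _ ≤ _ := Nat.mul_le_mul_left _ hi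
  rw [expLCS_eq]
  rw [← avgS_window hk h5]
  congr 1
  funext x
  rw [← avgS_window (N := 2*d*m) (a := r i) (b := r (i+1) - r i) hk (by omega)]

/-- **Inequality (differenceexpectation).** For any partition `r⃗ ∈ R^n \ R^n(ε)` and any
`n = 2dm` with `E LC*_n ≥ γ*_k n - (n/4)(γ*_k - γ^e_k) p ε`, one has
`E(LC*_n(r⃗) - LC*_n) ≤ -(3/4)(γ*_k - γ^e_k) p ε n`. -/
theorem expected_score_sub_LCstar_le
    {Ω : Type*} [MeasurableSpace Ω] (P : MeasureTheory.Measure Ω)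
    [MeasureTheory.IsProbabilityMeasure P]
    (k d m : ℕ) (hk : 2 ≤ k) (hd : 1 ≤ d) (hm : 1 ≤ m)
    (Xstar Y : Ω → ℕ → Fin k) (hmX : Measurable Xstar) (hmY : Measurable Y)
    (hlaw : MeasureTheory.Measure.map
        (fun ω => ((fun i : Fin (2*d*m) => Xstar ω i), (fun i : Fin (2*d*m) => Y ω i))) P
      = (unifM (Fin (2*d*m) → Fin k)).prod (unifM (Fin (2*d*m) → Fin k)))
    (γe p ε qe : ℝ) (hγe : γe < gammaLim k 0) (hqe : 0 < qe ∧ qe < 1)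
    (hγqe : gammaLim k qe = γe) (hp : 0 < p ∧ p < 1) (hε : 0 < ε)
    (r : ℕ → ℕ) (hr : IsPartition (2*d*m) m r)
    (hnot : ¬ memReps d m p ε qe (2*d*m) r)
    (hexp : gammaLim k 0 * (2*d*m : ℝ) - ((2*d*m : ℝ)/4) * (gammaLim k 0 - γe) * p * ε
      ≤ ∫ ω, (lcsLength (strN (Xstar ω) (2*d*m)) (strN (Y ω) (2*d*m)) : ℝ) ∂P) :
    ∫ ω, ((score d m r (strN (Xstar ω) (2*d*m)) (strN (Y ω) (2*d*m)) : ℝ)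
        - (lcsLength (strN (Xstar ω) (2*d*m)) (strN (Y ω) (2*d*m)) : ℝ)) ∂P
      ≤ -(3/4) * (gammaLim k 0 - γe) * p * ε * (2*d*m : ℝ) := by
  have hint : ∀ G : List (Fin k) → List (Fin k) → ℝ,
      MeasureTheory.Integrable (fun ω => G (strN (Xstar ω) (2*d*m)) (strN (Y ω) (2*d*m))) P := by
    intro G
    have hs : ∀ x : ℕ → Fin k, strN x (2*d*m) = List.ofFn (fun i : Fin (2*d*m) => x i) := by
      intro x
      unfold strN
      apply List.ext_getElem <;> simp
    simp_rw [hs]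
    have hM : Measurable (fun ω =>
        ((fun i : Fin (2*d*m) => Xstar ω i), (fun i : Fin (2*d*m) => Y ω i))) := by
      refine Measurable.prodMk ?_ ?_ <;> refine measurable_pi_lambda _ fun i => ?_
      · exact (measurable_pi_apply _).comp hmX
      · exact (measurable_pi_apply _).comp hmY
    exact (MeasureTheory.Integrable.of_finite (μ := MeasureTheory.Measure.map _ P)
      (f := fun z : (Fin (2*d*m) → Fin k) × (Fin (2*d*m) → Fin k) =>
        G (List.ofFn z.1) (List.ofFn z.2))).comp_measurable hM
  rw [MeasureTheory.integral_sub (hint fun x y => (score d m r x y : ℝ))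
    (hint fun x y => (lcsLength x y : ℝ))]
  have hsc := integral_strN P k (2*d*m) hk Xstar Y hmX hmY hlaw
    (fun x y => (score d m r x y : ℝ))
  rw [avg_score hk r hr] at hsc
  rw [hsc]
  have hbad : 2*(m:ℝ)*p*ε < badCount d m qe r := by
    by_contra! hc
    exact hnot ⟨hr, hc⟩
  have hd0 : (0 : ℝ) < d := by exact_mod_cast hd
  set D := gammaLim k 0 - γe with hD
  have hDpos : 0 < D := by linarith
  have hterm : ∀ i ∈ Finset.range m, expLCS k (2*d) (r (i+1) - r i) ≤
      (2*d + ((r (i+1) : ℝ) - r i)) / 2 * gammaLim k 0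
        - (if ¬ inI d qe ((r (i+1) : ℝ) - (r i : ℝ)) then d * D else 0) := by
    intro i hi
    have hri := hr.2.1 i (Finset.mem_range.1 hi)
    have hcast : ((r (i+1) - r i : ℕ) : ℝ) = (r (i+1) : ℝ) - r i := Nat.cast_sub hri
    set t : ℝ := (r (i+1) : ℝ) - r i with ht
    have ht0 : 0 ≤ t := by rw [← hcast]; positivity
    by_cases hI : ¬ inI d qe t
    · rw [if_pos hI]
      have h := expLCS_le_gamma' hk (2*d) (r (i+1) - r i) (by omega) qe hqe.1.le hqe.2.le
      rw [hcast] at h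
      push_cast at h
      have hq : qe * (2 * d + t) ≤ |t - 2 * d| := by
        unfold inI at hI
        rw [not_and_or, not_le, not_le, lt_div_iff₀ (by linarith [hqe.1]),
          div_lt_iff₀ (by linarith [hqe.2])] at hI
        rcases hI with hI | hI
        · rw [abs_sub_comm]
          refine le_trans ?_ (le_abs_self _)
          linarith
        · refine le_trans ?_ (le_abs_self _)
          linarith
      have h := h hq
      rw [hγqe] at h
      have : d * D ≤ (2 * d + t) / 2 * D := by
        gcongr; linarith
      rw [hD] at this ⊢
      linarith
    · rw [if_neg hI]
      have h := expLCS_le_gamma' hk (2*d) (r (i+1) - r i) (by omega) 0 le_rfl zero_le_one (by simp)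
      rw [hcast] at h
      push_cast at h
      linarith
  have hsum := Finset.sum_le_sum hterm
  rw [Finset.sum_sub_distrib, ← Finset.sum_mul, ← Finset.sum_div, Finset.sum_add_distrib,
    Finset.sum_range_sub (fun i => (r i : ℝ)), ← Finset.sum_filter, Finset.sum_const,
    Finset.sum_const, hr.1, hr.2.2] at hsum
  simp only [nsmul_eq_mul, Finset.card_range] at hsum
  change _ ≤ _ - (badCount d m qe r : ℝ) * (d * D) at hsum
  have hb : 2*(m:ℝ)*p*ε * (d * D) ≤ (badCount d m qe r : ℝ) * (d * D) := by
    gcongr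
  push_cast at hsum
  linarith
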